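/- Fix a prime p ≥ 2 and let r ≥ 3 with p ∤ (r−1) and p odd. Define, for each N ≥ 0, a_N = p^{−N} · ∏_{k=1}^∞ (1 − p^{−(2k−1)}). Then (a_N)_{N≥0} together with the values b_G = N(G)·∏_{k=1}^∞(1 − p^{−(2k−1)}) over non-cyclic finite abelian p-groups G sum to 1; in particular ∑_{G} N(G) = ∏_{k=1}^∞ (1 − p^{−(2k−1)})⁻¹, where the sum runs over all isomorphism classes of finite abelian p-groups and N(G) = p^{−∑ᵢ μᵢ(μᵢ+1)/2} ∏_{i=1}^{λ₁} ∏_{j=1}^{⌊(μᵢ−μ_{i+1})/2⌋} (1 − p^{−2j})⁻¹. -/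

import Mathlib

/-- The Cohen–Lenstra-type weight `N(G)` of a finite abelian `p`-group, encoded by
the partition `λ` (with conjugate partition `μᵢ = #{j : λⱼ ≥ i}` and largest part
`λ₁`): `N(G) = p^{−∑ᵢ μᵢ(μᵢ+1)/2} ∏_{i=1}^{λ₁} ∏_{j=1}^{⌊(μᵢ−μ_{i+1})/2⌋}
(1 − p^{−2j})⁻¹`. -/
noncomputable def symCLweight (p : ℕ) (P : Σ n : ℕ, n.Partition) : ℝ :=
  let μ : ℕ → ℕ := fun i => (Multiset.filter (fun a => i ≤ a) P.2.parts).card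
  let l1 : ℕ := P.2.parts.sup
  ((p : ℝ))⁻¹ ^ (∑ i ∈ Finset.Icc 1 l1, μ i * (μ i + 1) / 2) *
    ∏ i ∈ Finset.Icc 1 l1,
      ∏ j ∈ Finset.Icc 1 ((μ i - μ (i + 1)) / 2), (1 - ((p : ℝ))⁻¹ ^ (2 * j))⁻¹

noncomputable def bCo (t : ℝ) (n : ℕ) : ℝ :=
  ∏ j ∈ Finset.Icc 1 (n / 2), (1 - t ^ (2 * j))⁻¹

noncomputable def cCo (t : ℝ) (n : ℕ) : ℝ := ∏ j ∈ Finset.range n, (1 - t ^ (j + 1))⁻¹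

noncomputable def FF (t : ℝ) (n : ℕ) : ℝ := t ^ (n * (n + 1) / 2) * cCo t n

lemma one_sub_pos {t : ℝ} (h0 : 0 < t) (h1 : t < 1) (n : ℕ) (hn : n ≠ 0) : 0 < 1 - t ^ n := by
  have := pow_lt_one₀ h0.le h1 hn
  linarith

lemma cCo_succ {t : ℝ} (h0 : 0 < t) (h1 : t < 1) (n : ℕ) :
    cCo t (n + 1) * (1 - t ^ (n + 1)) = cCo t n := by
  have := (one_sub_pos h0 h1 (n + 1) (by omega)).ne'
  unfold cCo
  rw [Finset.prod_range_succ, mul_assoc, inv_mul_cancel₀ this, mul_one]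

lemma cCo_pos {t : ℝ} (h0 : 0 < t) (h1 : t < 1) (n : ℕ) : 0 < cCo t n :=
  Finset.prod_pos fun j _ => inv_pos.2 (one_sub_pos h0 h1 (j + 1) (by omega))

lemma FF_pos {t : ℝ} (h0 : 0 < t) (h1 : t < 1) (n : ℕ) : 0 < FF t n :=
  mul_pos (pow_pos h0 _) (cCo_pos h0 h1 n)

lemma bCo_pos {t : ℝ} (h0 : 0 < t) (h1 : t < 1) (n : ℕ) : 0 < bCo t n :=
  Finset.prod_pos fun j hj => inv_pos.2 (one_sub_pos h0 h1 (2 * j) (by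
    have := (Finset.mem_Icc.1 hj).1
    omega))

lemma tri_succ (n : ℕ) : (n + 1) * (n + 1 + 1) / 2 = n * (n + 1) / 2 + (n + 1) := by
  have : (n + 1) * (n + 1 + 1) = n * (n + 1) + (n + 1) * 2 := by ring
  rw [this, Nat.add_mul_div_right _ _ (by norm_num)]

lemma FF_succ {t : ℝ} (h0 : 0 < t) (h1 : t < 1) (n : ℕ) :
    FF t (n + 1) * (1 - t ^ (n + 1)) = t ^ (n + 1) * FF t n := by
  unfold FF
  rw [mul_assoc, cCo_succ h0 h1, tri_succ, pow_add]
  ring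

lemma bCo_step {t : ℝ} (h0 : 0 < t) (h1 : t < 1) (n : ℕ) :
    bCo t (2 * (n + 1)) * (1 - t ^ (2 * (n + 1))) = bCo t (2 * n) := by
  have := (one_sub_pos h0 h1 (2 * (n + 1)) (by omega)).ne'
  unfold bCo
  rw [Nat.mul_div_cancel_left _ (by norm_num), Nat.mul_div_cancel_left _ (by norm_num),
    Finset.prod_Icc_succ_top (by omega), mul_assoc, inv_mul_cancel₀ this, mul_one]

lemma bCo_odd (t : ℝ) (n : ℕ) : bCo t (2 * n + 1) = bCo t (2 * n) := by
  unfold bCo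
  congr 2
  omega

lemma bCo_rec {t : ℝ} (h0 : 0 < t) (h1 : t < 1) (n : ℕ) :
    bCo t (n + 2) * t ^ (n + 2) = bCo t (n + 2) - (1 - t) * bCo t (n + 1) - t * bCo t n := by
  rcases Nat.even_or_odd' n with ⟨k, rfl | rfl⟩
  · have h := bCo_step h0 h1 k
    rw [bCo_odd, show 2 * k + 2 = 2 * (k + 1) by ring]
    linear_combination -h
  · have h := bCo_step h0 h1 k
    rw [bCo_odd, show 2 * k + 1 + 2 = 2 * (k + 1) + 1 by ring,
      show 2 * k + 1 + 1 = 2 * (k + 1) by ring, bCo_odd]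
    linear_combination -t * h

open PowerSeries in
lemma qconv {t : ℝ} (h0 : 0 < t) (h1 : t < 1) (m : ℕ) :
    ∑ k ∈ Finset.range (m + 1), FF t k * bCo t (m - k) = cCo t m := by
  set A : PowerSeries ℝ := PowerSeries.mk (FF t) with hA
  set B : PowerSeries ℝ := PowerSeries.mk (bCo t) with hB
  have eA : A = (1 + C t * X) * rescale t A := by
    ext n
    rw [add_mul, one_mul, mul_assoc, map_add, coeff_C_mul]
    cases n with
    | zero => simp [hA]
    | succ n =>
      rw [coeff_succ_X_mul, coeff_rescale, coeff_rescale, hA, coeff_mk, coeff_mk]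
      linear_combination FF_succ h0 h1 n
  have eB : rescale t B = (1 + C t * X) * ((1 - X) * B) := by
    have : (1 + C t * X) * ((1 - X) * B) = B - C (1 - t) * (X * B) - C t * (X * (X * B)) := by
      rw [map_sub, map_one]; ring
    rw [this]
    ext n
    rw [map_sub, map_sub, coeff_C_mul, coeff_C_mul, coeff_rescale]
    rcases n with _ | _ | n
    · simp
    · rw [coeff_succ_X_mul, coeff_succ_X_mul]
      simp [hB, bCo]
    · rw [coeff_succ_X_mul, coeff_succ_X_mul, coeff_succ_X_mul]
      simp only [hB, coeff_mk]
      linear_combination bCo_rec h0 h1 n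
  have eC : rescale t (A * B) = A * B - X * (A * B) := by
    rw [map_mul, eB]
    nth_rewrite 2 [eA]
    nth_rewrite 3 [eA]
    ring
  have key : ∀ m, coeff m (A * B) = cCo t m := by
    intro m
    induction m with
    | zero => simp [hA, hB, FF, cCo, bCo]
    | succ m ih =>
      have h := congrArg (coeff (m + 1)) eC
      rw [coeff_rescale, map_sub, coeff_succ_X_mul, ih] at h
      have h2 := cCo_succ h0 h1 m
      have h3 := (one_sub_pos h0 h1 (m + 1) (by omega)).ne'
      apply mul_right_cancel₀ h3
      linear_combination -h - h2
  rw [← key m, coeff_mul, Finset.Nat.sum_antidiagonal_eq_sum_range_succ_mk]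
  simp [hA, hB]

lemma FF_ratio {t : ℝ} (h0 : 0 < t) (h1 : t < 1) (n : ℕ) :
    FF t (n + 1) = t ^ (n + 1) / (1 - t ^ (n + 1)) * FF t n := by
  have h3 := (one_sub_pos h0 h1 (n + 1) (by omega)).ne'
  field_simp
  linear_combination FF_succ h0 h1 n

open Filter Topology in
lemma FF_summable {t : ℝ} (h0 : 0 < t) (h1 : t < 1) : Summable (FF t) := by
  apply summable_of_ratio_test_tendsto_lt_one (l := 0) one_pos
    (Eventually.of_forall fun n => (FF_pos h0 h1 n).ne')
  have hp : Tendsto (fun n : ℕ => t ^ (n + 1)) atTop (𝓝 0) :=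
    (tendsto_add_atTop_iff_nat 1).2 (tendsto_pow_atTop_nhds_zero_of_lt_one h0.le h1)
  have : Tendsto (fun n : ℕ => t ^ (n + 1) / (1 - t ^ (n + 1))) atTop (𝓝 (0 / (1 - 0))) :=
    hp.div (tendsto_const_nhds.sub hp) (by norm_num)
  rw [zero_div] at this
  refine this.congr fun n => ?_
  rw [FF_ratio h0 h1, norm_mul, mul_div_cancel_right₀ _ (by simpa using (FF_pos h0 h1 n).ne'),
    Real.norm_of_nonneg]
  exact div_nonneg (by positivity) (one_sub_pos h0 h1 (n + 1) (by omega)).le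

open Filter Topology in
lemma FF_hasSum {t : ℝ} (h0 : 0 < t) (h1 : t < 1) :
    HasSum (FF t) (∏' k : ℕ, (1 + t ^ (k + 1))) := by
  have hs := FF_summable h0 h1
  have hsz : ∀ n : ℕ, Summable (fun k => FF t k * (t ^ n) ^ k) := by
    intro n
    refine Summable.of_nonneg_of_le (fun k => by have := FF_pos h0 h1 k; positivity) (fun k => ?_) hs
    exact mul_le_of_le_one_right (FF_pos h0 h1 k).le
      (pow_le_one₀ (by positivity) (pow_le_one₀ h0.le h1.le))
  have step : ∀ n : ℕ, ∑' k, FF t k * (t ^ n) ^ k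
      = (1 + t ^ (n + 1)) * ∑' k, FF t k * (t ^ (n + 1)) ^ k := by
    intro n
    have e : ∀ k, FF t (k + 1) * (t ^ n) ^ (k + 1) =
        FF t (k + 1) * (t ^ (n + 1)) ^ (k + 1) + t ^ (n + 1) * (FF t k * (t ^ (n + 1)) ^ k) := by
      intro k
      have h := FF_succ h0 h1 k
      have e1 : (t ^ (n + 1)) ^ (k + 1) = t ^ (k + 1) * (t ^ n) ^ (k + 1) := by ring
      have e2 : t ^ (n + 1) * (t ^ (n + 1)) ^ k = t ^ (k + 1) * (t ^ n) ^ (k + 1) := by ring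
      linear_combination (t ^ n) ^ (k + 1) * h - FF t (k + 1) * e1 - FF t k * e2
    rw [(hsz n).tsum_eq_zero_add, tsum_congr e, Summable.tsum_add
      ((summable_nat_add_iff 1).2 (hsz (n + 1))) ((hsz (n + 1)).mul_left _), tsum_mul_left]
    have := (hsz (n + 1)).tsum_eq_zero_add
    simp only [pow_zero] at this ⊢
    linear_combination -this
  have fin : ∀ n : ℕ, ∑' k, FF t k
      = (∏ j ∈ Finset.range n, (1 + t ^ (j + 1))) * ∑' k, FF t k * (t ^ n) ^ k := by
    intro n
    induction n with
    | zero => simp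
    | succ n ih => rw [ih, step n, Finset.prod_range_succ]; ring
  have lim : Tendsto (fun n : ℕ => ∑' k, FF t k * (t ^ n) ^ k) atTop
      (𝓝 (∑' k, if k = 0 then (1 : ℝ) else 0)) := by
    apply tendsto_tsum_of_dominated_convergence hs
    · intro k
      rcases Nat.eq_zero_or_pos k with rfl | hk
      · simp [FF, cCo]
      · rw [if_neg hk.ne']
        have : Tendsto (fun n : ℕ => FF t k * (t ^ k) ^ n) atTop (𝓝 (FF t k * 0)) :=
          (tendsto_pow_atTop_nhds_zero_of_lt_one (by positivity)
            (pow_lt_one₀ h0.le h1 hk.ne')).const_mul _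
        rw [mul_zero] at this
        refine this.congr fun n => ?_
        rw [← pow_mul, ← pow_mul, mul_comm k n]
    · refine Eventually.of_forall fun n k => ?_
      have := FF_pos h0 h1 k
      rw [Real.norm_of_nonneg (by positivity)]
      exact mul_le_of_le_one_right this.le
        (pow_le_one₀ (by positivity) (pow_le_one₀ h0.le h1.le))
  rw [tsum_ite_eq] at lim
  have hm : Multipliable (fun k : ℕ => 1 + t ^ (k + 1)) := by
    apply multipliable_one_add_of_summable
    simpa [abs_of_pos h0] using (summable_nat_add_iff 1).2 (summable_geometric_of_lt_one h0.le h1)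
  have l2 := hm.hasProd.tendsto_prod_nat.mul lim
  have := tendsto_nhds_unique (l2.congr fun n => (fin n).symm) tendsto_const_nhds
  rw [mul_one] at this
  rw [this]
  exact hs.hasSum

lemma euler_prod {t : ℝ} (h0 : 0 < t) (h1 : t < 1) :
    (∏' k : ℕ, (1 + t ^ (k + 1))) * ∏' k : ℕ, (1 - t ^ (2 * k + 1)) = 1 := by
  have hg : Summable (fun k : ℕ => t ^ k) := summable_geometric_of_lt_one h0.le h1
  have gen : ∀ f : ℕ → ℕ, Function.Injective f → Summable (fun k => ‖- t ^ (f k)‖) := by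
    intro f hf
    simpa [abs_of_pos h0, Function.comp_def] using hg.comp_injective hf
  have mul : ∀ f : ℕ → ℕ, Function.Injective f → Multipliable (fun k => 1 - t ^ (f k)) := by
    intro f hf
    simpa [sub_eq_add_neg] using multipliable_one_add_of_summable (gen f hf)
  have mo := mul (fun k => 2 * k + 1) (fun a b h => by simpa using h)
  have me := mul (fun k => 2 * k + 1 + 1) (fun a b h => by simpa using h)
  have ma := mul (fun k => k + 1) (fun a b h => by simpa using h)
  have mp : Multipliable (fun k : ℕ => 1 + t ^ (k + 1)) := by
    apply multipliable_one_add_of_summable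
    simpa [abs_of_pos h0] using (summable_nat_add_iff 1).2 hg
  have hne : ∏' k : ℕ, (1 - t ^ (k + 1)) ≠ 0 := by
    have := tprod_one_add_ne_zero_of_summable (f := fun k : ℕ => - t ^ (k + 1))
      (fun k => by
        have := one_sub_pos h0 h1 (k + 1) (by omega)
        rw [← sub_eq_add_neg]; exact this.ne') (gen _ (fun a b h => by simpa using h))
    simpa [sub_eq_add_neg] using this
  have e1 : (∏' k : ℕ, (1 - t ^ (2 * k + 1))) * ∏' k : ℕ, (1 - t ^ (2 * k + 1 + 1))
      = ∏' k : ℕ, (1 - t ^ (k + 1)) :=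
    tprod_even_mul_odd (f := fun k : ℕ => 1 - t ^ (k + 1)) mo me
  have e2 : (∏' k : ℕ, (1 + t ^ (k + 1))) * ∏' k : ℕ, (1 - t ^ (k + 1))
      = ∏' k : ℕ, (1 - t ^ (2 * k + 1 + 1)) := by
    rw [← mp.tprod_mul ma]
    apply tprod_congr
    intro k
    ring
  apply mul_right_cancel₀ hne
  rw [one_mul, mul_right_comm, e2, mul_comm, e1]

/-- multisets of `m` positive naturals -/
abbrev MM (m : ℕ) : Type := {s : Multiset ℕ // 0 ∉ s ∧ s.card = m}

lemma pred_succ_aux (s : Multiset ℕ) (k : ℕ) (hs : 0 ∉ s) :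
    (((s.map Nat.succ + Multiset.replicate k 1)).filter (2 ≤ ·)).map Nat.pred = s := by
  rw [Multiset.filter_add, Multiset.map_add, Multiset.filter_map, Multiset.map_map]
  have h1 : (Multiset.replicate k 1).filter (2 ≤ ·) = 0 := by
    rw [Multiset.filter_eq_nil]
    intro a ha
    rw [Multiset.eq_of_mem_replicate ha]; omega
  have h2 : s.filter ((2 ≤ ·) ∘ Nat.succ) = s := by
    rw [Multiset.filter_eq_self]
    intro a ha
    have : a ≠ 0 := fun h => hs (h ▸ ha)
    simp; omega
  rw [h1, h2]
  simp

lemma succ_pred_aux (s : Multiset ℕ) (hs : 0 ∉ s) :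
    ((s.filter (2 ≤ ·)).map Nat.pred).map Nat.succ
      + Multiset.replicate (s.card - (s.filter (2 ≤ ·)).card) 1 = s := by
  rw [Multiset.map_map]
  have h1 : (s.filter (2 ≤ ·)).map (Nat.succ ∘ Nat.pred) = s.filter (2 ≤ ·) := by
    conv_rhs => rw [← Multiset.map_id (s.filter (2 ≤ ·))]
    apply Multiset.map_congr rfl
    intro a ha
    have := (Multiset.mem_filter.1 ha).2
    simp only [Function.comp, id]
    exact Nat.succ_pred (by omega)
  have h2 : Multiset.replicate (s.card - (s.filter (2 ≤ ·)).card) 1 = s.filter (fun a => ¬ 2 ≤ a) := by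
    symm
    rw [Multiset.eq_replicate]
    constructor
    · have h3 := congrArg Multiset.card (Multiset.filter_add_not (2 ≤ ·) s)
      rw [Multiset.card_add] at h3
      omega
    · intro b hb
      have := Multiset.mem_filter.1 hb
      have h0 : b ≠ 0 := fun h => hs (h ▸ this.1)
      omega
  rw [h1, h2, Multiset.filter_add_not]

def predM {m : ℕ} (s : MM m) : Multiset ℕ := (s.1.filter (2 ≤ ·)).map Nat.pred

lemma zero_notMem_pred (s : Multiset ℕ) : 0 ∉ (s.filter (2 ≤ ·)).map Nat.pred := by
  intro h
  obtain ⟨a, ha, h⟩ := Multiset.mem_map.1 h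
  have := (Multiset.mem_filter.1 ha).2
  have : a.pred = a - 1 := rfl
  omega

lemma MM_sigma_ext {m : ℕ} (x y : Σ k : Fin (m + 1), MM k) (h : x.2.1 = y.2.1) : x = y := by
  rcases x with ⟨⟨k, hk⟩, s, hs, h1⟩
  rcases y with ⟨⟨k', hk'⟩, s', hs', h1'⟩
  simp only at h h1 h1'
  subst h
  have : k = k' := by omega
  subst this
  rfl

def MMequiv (m : ℕ) : (Σ k : Fin (m + 1), MM k) ≃ MM m where
  toFun x := ⟨x.2.1.map Nat.succ + Multiset.replicate (m - x.1) 1, by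
    have h1 := x.2.2.2
    have h2 := x.1.2
    constructor
    · intro h
      rcases Multiset.mem_add.1 h with h | h
      · simp at h
      · have := Multiset.eq_of_mem_replicate h
        omega
    · simp only [Multiset.card_add, Multiset.card_map, Multiset.card_replicate]
      omega⟩
  invFun s := ⟨⟨(predM s).card, by
      have := Multiset.card_le_card (Multiset.filter_le (2 ≤ ·) s.1)
      rw [s.2.2] at this
      unfold predM
      rw [Multiset.card_map]
      omega⟩, ⟨predM s, zero_notMem_pred _, rfl⟩⟩
  left_inv := by
    intro x
    apply MM_sigma_ext
    exact pred_succ_aux x.2.1 (m - x.1) x.2.2.1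
  right_inv := by
    rintro ⟨s, hs, rfl⟩
    apply Subtype.ext
    have := succ_pred_aux s hs
    simp only [predM, Multiset.card_map]
    exact this

def mu (s : Multiset ℕ) (i : ℕ) : ℕ := (Multiset.filter (fun a => i ≤ a) s).card

noncomputable def wt (t : ℝ) (s : Multiset ℕ) : ℝ :=
  t ^ (∑ i ∈ Finset.Icc 1 s.sup, mu s i * (mu s i + 1) / 2) *
    ∏ i ∈ Finset.Icc 1 s.sup, bCo t (mu s i - mu s (i + 1))

noncomputable def term (t : ℝ) (m k : ℕ) : ℝ := t ^ (m * (m + 1) / 2) * bCo t (m - k)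

lemma mu_eq_zero (s : Multiset ℕ) (i : ℕ) (h : s.sup < i) : mu s i = 0 := by
  unfold mu
  rw [Multiset.card_eq_zero, Multiset.filter_eq_nil]
  intro a ha
  have := Multiset.le_sup ha
  omega

lemma wt_eq (t : ℝ) (s : Multiset ℕ) (L : ℕ) (h : s.sup ≤ L) :
    wt t s = ∏ i ∈ Finset.range L, term t (mu s (i + 1)) (mu s (i + 2)) := by
  unfold wt term
  rw [← Finset.prod_pow_eq_pow_sum, ← Finset.prod_mul_distrib]
  have : ∀ n, Finset.Icc 1 n = (Finset.range n).image (· + 1) := by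
    intro n; ext a; simp only [Finset.mem_Icc, Finset.mem_image, Finset.mem_range]
    constructor
    · intro h; exact ⟨a - 1, by omega, by omega⟩
    · rintro ⟨b, h, rfl⟩; omega
  rw [this, Finset.prod_image (by intro a _ b _ h; simpa using h)]
  apply Finset.prod_subset (by simpa using h)
  intro x _ hx
  simp only [Finset.mem_range, not_lt] at hx
  rw [mu_eq_zero s (x + 1) (by omega)]
  simp [bCo]

lemma mu_zero_sup_pred (s : Multiset ℕ) (k : ℕ) (i : ℕ) :
    mu (s.map Nat.succ + Multiset.replicate k 1) (i + 2) = mu s (i + 1) := by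
  unfold mu
  rw [Multiset.filter_add, Multiset.filter_map]
  have h1 : (Multiset.replicate k 1).filter (i + 2 ≤ ·) = 0 := by
    rw [Multiset.filter_eq_nil]
    intro a ha
    rw [Multiset.eq_of_mem_replicate ha]; omega
  rw [h1]
  simp

lemma mu_one (s : Multiset ℕ) (hs : 0 ∉ s) : mu s 1 = s.card := by
  unfold mu
  congr 1
  rw [Multiset.filter_eq_self]
  intro a ha
  have : a ≠ 0 := fun h => hs (h ▸ ha)
  omega

lemma sup_succ (s : Multiset ℕ) (k L : ℕ) :
    (s.map Nat.succ + Multiset.replicate k 1).sup ≤ L + 1 ↔ s.sup ≤ L := by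
  rw [Multiset.sup_le, Multiset.sup_le]
  constructor
  · intro h b hb
    have := h (b.succ) (Multiset.mem_add.2 (Or.inl (Multiset.mem_map_of_mem _ hb)))
    omega
  · intro h b hb
    rcases Multiset.mem_add.1 hb with hb | hb
    · obtain ⟨a, ha, rfl⟩ := Multiset.mem_map.1 hb
      have := h a ha
      simp; omega
    · rw [Multiset.eq_of_mem_replicate hb]; omega

lemma wt_equiv (t : ℝ) (m : ℕ) (x : Σ k : Fin (m + 1), MM k) :
    wt t (MMequiv m x).1 = term t m x.1 * wt t x.2.1 := by
  have h0 := (MMequiv m x).2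
  have e : (MMequiv m x).1 = x.2.1.map Nat.succ + Multiset.replicate (m - x.1) 1 := rfl
  have hm : mu (MMequiv m x).1 1 = m := by rw [mu_one _ h0.1, h0.2]
  have hk : mu (MMequiv m x).1 2 = x.1 := by
    rw [e, mu_zero_sup_pred _ _ 0, mu_one _ x.2.2.1, x.2.2.2]
  rw [wt_eq t _ (x.2.1.sup + 1) (by rw [e, sup_succ]), Finset.prod_range_succ',
    wt_eq t x.2.1 _ le_rfl, mul_comm]
  simp only [zero_add]
  rw [hm, hk]
  congr 1
  apply Finset.prod_congr rfl
  intro i _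
  rw [e, mu_zero_sup_pred _ _ i, mu_zero_sup_pred _ _ (i + 1)]

def parEquiv : (Σ n : ℕ, n.Partition) ≃ Σ m, MM m where
  toFun P := ⟨P.2.parts.card, P.2.parts, fun h => absurd (P.2.parts_pos h) (lt_irrefl 0), rfl⟩
  invFun s := ⟨s.2.1.sum, s.2.1, by
    intro i hi
    rcases Nat.eq_zero_or_pos i with h | h
    · exact absurd (h ▸ hi) s.2.2.1
    · exact h, rfl⟩
  left_inv := by rintro ⟨n, ⟨s, h, rfl⟩⟩; rfl
  right_inv := by rintro ⟨m, ⟨s, h, rfl⟩⟩; rfl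


/-- total weight of partitions with `m` parts -/
noncomputable def gg (t : ℝ) (m : ℕ) : ENNReal := ∑' s : MM m, ENNReal.ofReal (wt t s.1)

noncomputable def gL (t : ℝ) (L m : ℕ) : ENNReal :=
  ∑' s : MM m, if s.1.sup ≤ L then ENNReal.ofReal (wt t s.1) else 0

lemma term_pos {t : ℝ} (h0 : 0 < t) (h1 : t < 1) (m k : ℕ) : 0 < term t m k :=
  mul_pos (pow_pos h0 _) (bCo_pos h0 h1 _)

lemma wt_pos {t : ℝ} (h0 : 0 < t) (h1 : t < 1) (s : Multiset ℕ) : 0 < wt t s :=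
  mul_pos (pow_pos h0 _) (Finset.prod_pos fun _ _ => bCo_pos h0 h1 _)

lemma gg_rec {t : ℝ} (h0 : 0 < t) (h1 : t < 1) (m : ℕ) :
    gg t m = ∑ k ∈ Finset.range (m + 1), ENNReal.ofReal (term t m k) * gg t k := by
  unfold gg
  rw [← (MMequiv m).tsum_eq, ENNReal.tsum_sigma', tsum_fintype, ← Fin.sum_univ_eq_sum_range
    (fun k => ENNReal.ofReal (term t m k) * ∑' s : MM k, ENNReal.ofReal (wt t s.1))]
  apply Finset.sum_congr rfl
  intro k _
  rw [← ENNReal.tsum_mul_left]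
  apply tsum_congr
  intro s
  rw [wt_equiv, ENNReal.ofReal_mul (term_pos h0 h1 _ _).le]

lemma gL_rec {t : ℝ} (h0 : 0 < t) (h1 : t < 1) (L m : ℕ) :
    gL t (L + 1) m = ∑ k ∈ Finset.range (m + 1), ENNReal.ofReal (term t m k) * gL t L k := by
  unfold gL
  rw [← (MMequiv m).tsum_eq, ENNReal.tsum_sigma', tsum_fintype, ← Fin.sum_univ_eq_sum_range
    (fun k => ENNReal.ofReal (term t m k) *
      ∑' s : MM k, if s.1.sup ≤ L then ENNReal.ofReal (wt t s.1) else 0)]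
  apply Finset.sum_congr rfl
  intro k _
  rw [← ENNReal.tsum_mul_left]
  apply tsum_congr
  intro s
  have e : (MMequiv m ⟨k, s⟩).1.sup ≤ L + 1 ↔ s.1.sup ≤ L := sup_succ s.1 (m - k) L
  rw [wt_equiv, ENNReal.ofReal_mul (term_pos h0 h1 _ _).le]
  by_cases h : s.1.sup ≤ L
  · rw [if_pos h, if_pos (e.2 h)]
  · rw [if_neg h, if_neg (fun h' => h (e.1 h')), mul_zero]

lemma FF_rec {t : ℝ} (h0 : 0 < t) (h1 : t < 1) (m : ℕ) :
    FF t m = ∑ k ∈ Finset.range (m + 1), term t m k * FF t k := by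
  conv_lhs => rw [FF, ← qconv h0 h1, Finset.mul_sum]
  apply Finset.sum_congr rfl
  intro k _
  unfold term
  ring

lemma MM_zero (s : MM 0) : s.1 = 0 := Multiset.card_eq_zero.1 s.2.2

noncomputable instance : Unique (MM 0) where
  default := ⟨0, by simp, by simp⟩
  uniq s := Subtype.ext (MM_zero s)

lemma gL_le {t : ℝ} (h0 : 0 < t) (h1 : t < 1) (L m : ℕ) :
    gL t L m ≤ ENNReal.ofReal (FF t m) := by
  induction L generalizing m with
  | zero =>
    cases m with
    | zero =>
      unfold gL
      rw [tsum_fintype, Fintype.sum_unique]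
      have : (default : MM 0).1 = 0 := rfl
      rw [this]
      simp [wt, FF, cCo]
    | succ m =>
      unfold gL
      rw [ENNReal.tsum_eq_zero.2]
      · exact zero_le
      · intro s
        rw [if_neg]
        intro h
        have hc : 0 < s.1.card := by rw [s.2.2]; omega
        obtain ⟨a, ha⟩ := Multiset.card_pos_iff_exists_mem.1 hc
        have h3 := Multiset.le_sup ha
        have h4 : a = 0 := by omega
        exact s.2.1 (h4 ▸ ha)
  | succ L ih =>
    rw [gL_rec h0 h1, FF_rec h0 h1, ENNReal.ofReal_sum_of_nonneg
      (fun k _ => (mul_pos (term_pos h0 h1 _ _) (FF_pos h0 h1 _)).le)]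
    apply Finset.sum_le_sum
    intro k _
    rw [ENNReal.ofReal_mul (term_pos h0 h1 _ _).le]
    exact mul_le_mul_right (ih k) _

lemma gg_le {t : ℝ} (h0 : 0 < t) (h1 : t < 1) (m : ℕ) :
    gg t m ≤ ENNReal.ofReal (FF t m) := by
  unfold gg
  rw [ENNReal.tsum_eq_iSup_sum]
  apply iSup_le
  intro S
  refine le_trans ?_ (gL_le h0 h1 (S.sup fun s => s.1.sup) m)
  refine le_trans ?_ (ENNReal.sum_le_tsum S)
  apply Finset.sum_le_sum
  intro s hs
  rw [if_pos (Finset.le_sup (f := fun s : MM m => s.1.sup) hs)]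

lemma gg_eq {t : ℝ} (h0 : 0 < t) (h1 : t < 1) (m : ℕ) :
    gg t m = ENNReal.ofReal (FF t m) := by
  have fin : ∀ k, gg t k ≠ ⊤ := fun k => ((gg_le h0 h1 k).trans_lt ENNReal.ofReal_lt_top).ne
  suffices h : (gg t m).toReal = FF t m by rw [← h, ENNReal.ofReal_toReal (fin m)]
  induction m using Nat.strong_induction_on with
  | _ m ih =>
    rcases Nat.eq_zero_or_pos m with rfl | hm
    · unfold gg
      rw [tsum_fintype, Fintype.sum_unique]
      have : (default : MM 0).1 = 0 := rfl
      rw [this]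
      simp [wt, FF, cCo]
    · have e := congrArg ENNReal.toReal (gg_rec h0 h1 m)
      rw [ENNReal.toReal_sum (fun k _ => ENNReal.mul_ne_top ENNReal.ofReal_ne_top (fin k))] at e
      simp only [ENNReal.toReal_mul, ENNReal.toReal_ofReal (term_pos h0 h1 _ _).le] at e
      have e2 := FF_rec h0 h1 m
      rw [Finset.sum_range_succ] at e e2
      rw [Finset.sum_congr rfl (fun k hk => by rw [ih k (Finset.mem_range.1 hk)])] at e
      have hpos : term t m m < 1 := by
        unfold term
        have : bCo t (m - m) = 1 := by simp [bCo]
        rw [this, mul_one]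
        apply pow_lt_one₀ h0.le h1
        obtain ⟨n, rfl⟩ : ∃ n, m = n + 1 := ⟨m - 1, by omega⟩
        rw [tri_succ]
        omega
      have h3 : 1 - term t m m ≠ 0 := by linarith
      apply mul_left_cancel₀ h3
      linear_combination e - e2

lemma symCLweight_eq (p : ℕ) (P : Σ n : ℕ, n.Partition) :
    symCLweight p P = wt (p : ℝ)⁻¹ P.2.parts := rfl

lemma total {t : ℝ} (h0 : 0 < t) (h1 : t < 1) :
    HasSum (fun P : Σ n : ℕ, n.Partition => wt t P.2.parts) (∏' k : ℕ, (1 + t ^ (k + 1))) := by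
  have hF := FF_hasSum h0 h1
  have e : ∑' P : Σ n : ℕ, n.Partition, ENNReal.ofReal (wt t P.2.parts)
      = ENNReal.ofReal (∏' k : ℕ, (1 + t ^ (k + 1))) := by
    rw [← hF.tsum_eq, ENNReal.ofReal_tsum_of_nonneg (fun n => (FF_pos h0 h1 n).le) hF.summable,
      ← parEquiv.symm.tsum_eq, ENNReal.tsum_sigma']
    apply tsum_congr
    intro m
    exact gg_eq h0 h1 m
  have hs : Summable (fun P : Σ n : ℕ, n.Partition => wt t P.2.parts) := by
    have := ENNReal.summable_toReal (e.trans_ne ENNReal.ofReal_ne_top)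
    refine this.congr fun P => ?_
    rw [ENNReal.toReal_ofReal (wt_pos h0 h1 _).le]
  rw [← ENNReal.ofReal_tsum_of_nonneg (fun P => (wt_pos h0 h1 _).le) hs] at e
  have := (ENNReal.ofReal_eq_ofReal_iff (tsum_nonneg fun P => (wt_pos h0 h1 _).le)
    (hF.tsum_eq ▸ tsum_nonneg fun n => (FF_pos h0 h1 n).le)).1 e
  rw [← this]
  exact hs.hasSum

/-- The weights `N(G)·∏_{k≥1}(1 − p^{−(2k−1)})` over all isomorphism classes of
finite abelian `p`-groups (equivalently, over all partitions) form a probability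
distribution; in particular `∑_G N(G) = ∏_{k≥1}(1 − p^{−(2k−1)})⁻¹`. -/
theorem symCLweight_sums_to_one (p : ℕ) (hp : p.Prime) (hodd : Odd p)
    (r : ℕ) (hr : 3 ≤ r) (hpr : ¬ p ∣ (r - 1)) :
    HasSum
      (fun P : Σ n : ℕ, n.Partition =>
        symCLweight p P * ∏' k : ℕ, (1 - ((p : ℝ))⁻¹ ^ (2 * k + 1))) 1 ∧
    (∑' P : Σ n : ℕ, n.Partition, symCLweight p P) =
      (∏' k : ℕ, (1 - ((p : ℝ))⁻¹ ^ (2 * k + 1)))⁻¹ := by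
  have h0 : (0 : ℝ) < (p : ℝ)⁻¹ := inv_pos.2 (by exact_mod_cast hp.pos)
  have h1 : (p : ℝ)⁻¹ < 1 := inv_lt_one_of_one_lt₀ (by exact_mod_cast hp.one_lt)
  have hT := total h0 h1
  have hE := euler_prod h0 h1
  constructor
  · have := hT.mul_right (∏' k : ℕ, (1 - ((p : ℝ))⁻¹ ^ (2 * k + 1)))
    rw [hE] at this
    exact this
  · exact hT.tsum_eq.trans (eq_inv_of_mul_eq_one_left hE)
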